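/- arXiv:1703.04817 — 4 statements merged into one kernel-verified Lean document; each statement's English description precedes it below -/
import Mathlib

section
/- Let d ≥ 1, let a, w_1,…,w_d ∈ ℂ with Re(a) > 0 and Re(w_i) > 0, let N be a non-negative integer, and let α ∈ ℂ with Re(α) > d and α not a positive integer. Let s : ℕ → ℂ and r > 0 satisfy Σ_{n=0}^∞ s_n z^n/n! = z^d ∏_{i=1}^d (e^{w_i z} − 1)^{−1} for all z with 0 < |z| < r. Then Σ_{n∈ℕ_0^d} (a+n·w)^{−α} = Σ_{n∈ℕ_0^d} [ (a+n·w)^{−α} − Σ_{m=0}^{N} (s_m/m!) · (Γ(1−α)/Γ(d−α−m+1)) · G[(a+n·w+x)^{d−α−m}]_{x=w} ] + (−1)^d Σ_{m=0}^{N} (s_m/m!) · (Γ(1−α)/Γ(d−α−m+1)) · a^{d−α−m}, where both infinite series converge absolutely (all complex powers are principal-branch). -/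
open Complex

namespace BarnesAux

/-- Iterated difference over the index set `T`. -/
noncomputable def dlt {ι : Type*} (w : ι → ℂ) (T : Finset ι) (f : ℂ → ℂ) (z : ℂ) : ℂ :=
  ∑ S ∈ T.powerset, (-1 : ℂ) ^ (T.card - S.card) * f (z + ∑ i ∈ S, w i)

theorem dlt_insert {ι : Type*} [DecidableEq ι] (w : ι → ℂ) (T : Finset ι) (j : ι) (hj : j ∉ T)
    (f : ℂ → ℂ) (z : ℂ) :
    dlt w (insert j T) f z = dlt w T f (z + w j) - dlt w T f z := by
  unfold dlt
  rw [Finset.sum_powerset_insert hj, Finset.card_insert_of_notMem hj, add_comm, sub_eq_add_neg,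
    ← Finset.sum_neg_distrib]
  congr 1
  · refine Finset.sum_congr rfl fun S hS => ?_
    have hS' := Finset.mem_powerset.1 hS
    have hjS : j ∉ S := fun h => hj (hS' h)
    rw [Finset.card_insert_of_notMem hjS, Finset.sum_insert hjS, Nat.add_sub_add_right, add_assoc]
  · refine Finset.sum_congr rfl fun S hS => ?_
    have hS' := Finset.card_le_card (Finset.mem_powerset.1 hS)
    rw [show T.card + 1 - S.card = (T.card - S.card) + 1 by omega, pow_succ]
    ring

theorem norm_cpow_le_re (β z : ℂ) (hβ : β.re ≤ 0) (hz : 0 < z.re) :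
    ‖z ^ β‖ ≤ Real.exp (Real.pi * |β.im|) * z.re ^ β.re := by
  have hz0 : z ≠ 0 := by rintro rfl; simp at hz
  rw [norm_cpow_of_ne_zero hz0, div_eq_mul_inv, ← Real.exp_neg, mul_comm]
  have h1 : ‖z‖ ^ β.re ≤ z.re ^ β.re :=
    Real.rpow_le_rpow_of_nonpos hz (re_le_norm z) hβ
  have h2 : -(arg z * β.im) ≤ Real.pi * |β.im| := by
    calc -(arg z * β.im) ≤ |arg z * β.im| := neg_le_abs _
      _ = |arg z| * |β.im| := abs_mul _ _
      _ ≤ _ := by gcongr; exact abs_arg_le_pi z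
  gcongr

theorem hasDerivAt_dlt {ι : Type*} (w : ι → ℂ) (hw : ∀ i, 0 < (w i).re) (T : Finset ι)
    (β z : ℂ) (hz : 0 < z.re) :
    HasDerivAt (dlt w T (fun x => x ^ β)) (β * dlt w T (fun x => x ^ (β - 1)) z) z := by
  unfold dlt
  rw [Finset.mul_sum]
  refine HasDerivAt.fun_sum fun S _ => ?_
  have hpos : 0 < (z + ∑ i ∈ S, w i).re := by
    rw [add_re, re_sum]
    have := Finset.sum_nonneg fun i (_ : i ∈ S) => (hw i).le
    linarith
  have h := ((hasDerivAt_id z).add_const (∑ i ∈ S, w i)).cpow_const (c := β) (Or.inl hpos)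
  refine (h.const_mul ((-1 : ℂ) ^ (T.card - S.card))).congr_deriv ?_
  simp only [id]
  ring

theorem dlt_bound {ι : Type*} (w : ι → ℂ) (hw : ∀ i, 0 < (w i).re) (T : Finset ι) :
    ∀ β : ℂ, β.re ≤ 0 → ∃ C : ℝ, 0 ≤ C ∧ ∀ z : ℂ, 0 < z.re →
      ‖dlt w T (fun x => x ^ β) z‖ ≤ C * z.re ^ (β.re - T.card) := by
  classical
  induction T using Finset.induction_on with
  | empty =>
    intro β hβ
    refine ⟨Real.exp (Real.pi * |β.im|), (Real.exp_pos _).le, fun z hz => ?_⟩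
    simpa [dlt] using norm_cpow_le_re β z hβ hz
  | insert j T hj ih =>
    intro β hβ
    obtain ⟨C, hC, h⟩ := ih (β - 1) (by simp; linarith)
    refine ⟨‖β‖ * C * ‖w j‖, by positivity, fun z hz => ?_⟩
    rw [dlt_insert w T j hj, Finset.card_insert_of_notMem hj]
    have hconv : Convex ℝ {x : ℂ | z.re ≤ x.re} := convex_halfSpace_re_ge _
    have key := hconv.norm_image_sub_le_of_norm_hasDerivWithin_le
      (f := dlt w T (fun x => x ^ β)) (f' := fun x => β * dlt w T (fun x => x ^ (β - 1)) x)
      (C := ‖β‖ * (C * z.re ^ (β.re - (T.card + 1)))) (x := z) (y := z + w j)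
      (fun x hx => (hasDerivAt_dlt w hw T β x (lt_of_lt_of_le hz hx)).hasDerivWithinAt)
      (fun x hx => by
        rw [norm_mul]
        have hx' : z.re ≤ x.re := hx
        gcongr
        refine (h x (lt_of_lt_of_le hz hx)).trans ?_
        gcongr
        have e : (β - 1).re - (T.card : ℝ) = β.re - (T.card + 1) := by simp; ring
        rw [e]
        refine Real.rpow_le_rpow_of_nonpos hz hx ?_
        have : (0 : ℝ) ≤ T.card := Nat.cast_nonneg _
        linarith)
      (show z.re ≤ z.re from le_rfl)
      (show z.re ≤ (z + w j).re by rw [add_re]; linarith [hw j])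
    refine key.trans (le_of_eq ?_)
    push_cast
    rw [add_sub_cancel_left]
    ring

theorem summable_pi_prod {d : ℕ} (g : Fin d → ℕ → ℝ) (hg : ∀ i k, 0 ≤ g i k)
    (hs : ∀ i, Summable (g i)) : Summable (fun n : Fin d → ℕ => ∏ i, g i (n i)) := by
  classical
  refine summable_of_sum_le (c := ∏ i, ∑' k, g i k)
    (fun n => Finset.prod_nonneg fun i _ => hg _ _) fun u => ?_
  have hsub : u ⊆ Fintype.piFinset (fun i => u.image (fun n => n i)) := by
    intro n hn
    rw [Fintype.mem_piFinset]
    exact fun i => Finset.mem_image_of_mem _ hn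
  calc ∑ n ∈ u, ∏ i, g i (n i)
      ≤ ∑ n ∈ Fintype.piFinset (fun i => u.image (fun n => n i)), ∏ i, g i (n i) :=
        Finset.sum_le_sum_of_subset_of_nonneg hsub
          fun n _ _ => Finset.prod_nonneg fun i _ => hg _ _
    _ = ∏ i, ∑ k ∈ u.image (fun n => n i), g i k := (Finset.prod_univ_sum _ _).symm
    _ ≤ _ := Finset.prod_le_prod (fun i _ => Finset.sum_nonneg fun k _ => hg _ _)
        fun i _ => (hs i).sum_le_tsum _ fun k _ => hg _ _

theorem summable_re {d : ℕ} (hd : 1 ≤ d) (b : ℝ) (hb : 0 < b) (v : Fin d → ℝ)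
    (hv : ∀ i, 0 < v i) (ρ : ℝ) (hρ : (d : ℝ) < ρ) :
    Summable (fun n : Fin d → ℕ => (b + ∑ i, (n i : ℝ) * v i) ^ (-ρ)) := by
  have hd0 : (0 : ℝ) < d := by exact_mod_cast hd
  have hp : 1 < ρ / d := by rwa [lt_div_iff₀ hd0, one_mul]
  have hsum : ∀ i, Summable (fun k : ℕ => (b + k * v i) ^ (-(ρ / d))) := by
    intro i
    have h := ((Real.summable_one_div_nat_add_rpow (b / v i) (ρ / d)).2 hp).mul_left
      (v i ^ (-(ρ / d)))
    refine h.congr fun k => ?_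
    have h1 : 0 < (k : ℝ) + b / v i := by have := hv i; positivity
    rw [abs_of_pos h1, one_div, ← Real.rpow_neg h1.le, ← Real.mul_rpow (hv i).le h1.le]
    congr 1
    have := (hv i).ne'
    field_simp
    ring
  refine Summable.of_nonneg_of_le (fun n => ?_) (fun n => ?_)
    (summable_pi_prod (fun i (k : ℕ) => (b + k * v i) ^ (-(ρ / d))) (fun i k => ?_) hsum)
  · have : 0 ≤ ∑ i, (n i : ℝ) * v i :=
      Finset.sum_nonneg fun i _ => mul_nonneg (Nat.cast_nonneg _) (hv i).le
    positivity
  · have h0 : ∀ i, 0 ≤ (n i : ℝ) * v i := fun i => mul_nonneg (Nat.cast_nonneg _) (hv i).le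
    have hX : 0 ≤ ∑ i, (n i : ℝ) * v i := Finset.sum_nonneg fun i _ => h0 i
    have e : (b + ∑ i, (n i : ℝ) * v i) ^ (-ρ)
        = ∏ _i : Fin d, (b + ∑ i, (n i : ℝ) * v i) ^ (-(ρ / d)) := by
      rw [Finset.prod_const, Finset.card_univ, Fintype.card_fin, ← Real.rpow_natCast,
        ← Real.rpow_mul (by positivity)]
      congr 1
      field_simp
    rw [e]
    refine Finset.prod_le_prod (fun i _ => by positivity) fun i _ => ?_
    refine Real.rpow_le_rpow_of_nonpos (by have := h0 i; positivity) ?_ (by linarith)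
    have := Finset.single_le_sum (fun j _ => h0 j) (Finset.mem_univ i)
    linarith
  · have := (hv i).le
    positivity

theorem box_sum {d : ℕ} (w : Fin d → ℂ) (f : ℂ → ℂ) (M : ℕ) :
    ∑ n ∈ Fintype.piFinset (fun _ : Fin d => Finset.range M),
      ∑ S : Finset (Fin d), (-1 : ℂ) ^ (d - S.card) *
        f ((∑ i, (n i : ℂ) * w i) + ∑ i ∈ S, w i)
      = ∑ S : Finset (Fin d), (-1 : ℂ) ^ (d - S.card) * f ((M : ℂ) * ∑ i ∈ S, w i) := by
  classical
  let L : AddMonoidAlgebra ℂ ℂ →+ ℂ :=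
    (Finsupp.linearCombination ℂ f).toAddMonoidHom.comp
      (AddMonoidAlgebra.coeffAddEquiv : AddMonoidAlgebra ℂ ℂ ≃+ (ℂ →₀ ℂ)).toAddMonoidHom
  have hL : ∀ x c : ℂ, L (AddMonoidAlgebra.single x c) = c * f x := by
    intro x c
    exact Finsupp.linearCombination_single ℂ c x
  let E : Fin d → AddMonoidAlgebra ℂ ℂ := fun i => AddMonoidAlgebra.single (w i) 1
  have hprod : ∀ (S : Finset (Fin d)) (m : Fin d → ℕ), ∏ i ∈ S, E i ^ m i
      = AddMonoidAlgebra.single (∑ i ∈ S, (m i : ℂ) * w i) 1 := by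
    intro S m
    induction S using Finset.induction_on with
    | empty => simp [AddMonoidAlgebra.one_def]
    | insert j S hj ih =>
      rw [Finset.prod_insert hj, Finset.sum_insert hj, ih]
      simp [E, AddMonoidAlgebra.single_pow, AddMonoidAlgebra.single_mul_single]
  have hexp : ∀ m : ℕ, ∏ i, (E i ^ m - 1) = ∑ S : Finset (Fin d),
      AddMonoidAlgebra.single ((m : ℂ) * ∑ i ∈ S, w i) ((-1 : ℂ) ^ (d - S.card)) := by
    intro m
    simp_rw [sub_eq_add_neg]
    rw [Fintype.prod_add]
    refine Finset.sum_congr rfl fun S _ => ?_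
    rw [hprod S (fun _ => m), Finset.prod_const, Finset.card_compl, Fintype.card_fin,
      ← Finset.mul_sum]
    rw [show (-1 : AddMonoidAlgebra ℂ ℂ) = AddMonoidAlgebra.single 0 (-1) by
      rw [AddMonoidAlgebra.one_def, AddMonoidAlgebra.single_neg]]
    rw [AddMonoidAlgebra.single_pow, AddMonoidAlgebra.single_mul_single]
    simp
  have main : (∑ n ∈ Fintype.piFinset (fun _ : Fin d => Finset.range M), ∏ i, E i ^ n i)
      * ∏ i, (E i ^ 1 - 1) = ∏ i, (E i ^ M - 1) := by
    rw [← Finset.prod_univ_sum (fun _ : Fin d => Finset.range M) (fun i k => E i ^ k),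
      ← Finset.prod_mul_distrib]
    refine Finset.prod_congr rfl fun i _ => ?_
    rw [pow_one, geom_sum_mul]
  have := congrArg L main
  rw [hexp, hexp, Finset.sum_mul, map_sum, map_sum] at this
  simp only [hL] at this
  rw [← this]
  refine Finset.sum_congr rfl fun n _ => ?_
  rw [hprod, Finset.mul_sum, map_sum]
  refine Finset.sum_congr rfl fun S _ => ?_
  rw [AddMonoidAlgebra.single_mul_single, hL]
  simp

theorem tendsto_box (d : ℕ) : Filter.Tendsto
    (fun M : ℕ => Fintype.piFinset (fun _ : Fin d => Finset.range M))
    Filter.atTop Filter.atTop := by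
  classical
  refine Filter.tendsto_atTop_finset_of_monotone (fun a b hab => ?_) fun n => ?_
  · exact Fintype.piFinset_subset _ _ fun _ => Finset.range_mono hab
  · refine ⟨∑ i, n i + 1, ?_⟩
    rw [Fintype.mem_piFinset]
    intro i
    rw [Finset.mem_range]
    have := Finset.single_le_sum (f := n) (fun j _ => Nat.zero_le _) (Finset.mem_univ i)
    omega

theorem tendsto_corner {d : ℕ} (a : ℂ) (w : Fin d → ℂ) (ha : 0 < a.re)
    (hw : ∀ i, 0 < (w i).re) (β : ℂ) (hβ : β.re < 0) :
    Filter.Tendsto (fun M : ℕ => ∑ S : Finset (Fin d), (-1 : ℂ) ^ (d - S.card) *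
      (a + (M : ℂ) * ∑ i ∈ S, w i) ^ β) Filter.atTop (nhds ((-1 : ℂ) ^ d * a ^ β)) := by
  classical
  have e : (-1 : ℂ) ^ d * a ^ β = ∑ S : Finset (Fin d),
      (if S = ∅ then (-1 : ℂ) ^ d * a ^ β else 0) := by simp
  rw [e]
  refine tendsto_finsetSum _ fun S _ => ?_
  by_cases hS : S = ∅
  · subst hS
    simp
  · rw [if_neg hS]
    rw [show (0 : ℂ) = (-1 : ℂ) ^ (d - S.card) * 0 by simp]
    refine Filter.Tendsto.const_mul _ ?_
    have hpos : 0 < ∑ i ∈ S, (w i).re :=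
      Finset.sum_pos (fun i _ => hw i) (Finset.nonempty_iff_ne_empty.2 hS)
    have hre : ∀ M : ℕ, (a + (M : ℂ) * ∑ i ∈ S, w i).re = a.re + M * ∑ i ∈ S, (w i).re := by
      intro M; simp
    have hlim : Filter.Tendsto (fun M : ℕ => a.re + M * ∑ i ∈ S, (w i).re)
        Filter.atTop Filter.atTop :=
      Filter.tendsto_atTop_add_const_left _ _
        (tendsto_natCast_atTop_atTop.atTop_mul_const hpos)
    have h2 := (tendsto_rpow_neg_atTop (y := -β.re) (by linarith)).comp hlim
    have h3 := h2.const_mul (Real.exp (Real.pi * |β.im|))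
    rw [mul_zero] at h3
    refine squeeze_zero_norm (fun M => ?_) h3
    have := norm_cpow_le_re β (a + (M : ℂ) * ∑ i ∈ S, w i) hβ.le (by
      rw [hre]; positivity)
    rw [hre] at this
    simpa using this

theorem summable_G {d : ℕ} (hd : 1 ≤ d) (a : ℂ) (w : Fin d → ℂ) (ha : 0 < a.re)
    (hw : ∀ i, 0 < (w i).re) (β : ℂ) (hβ : β.re < 0) :
    Summable (fun n : Fin d → ℕ => ‖∑ S : Finset (Fin d), (-1 : ℂ) ^ (d - S.card) *
      (a + (∑ i, (n i : ℂ) * w i) + ∑ i ∈ S, w i) ^ β‖) := by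
  obtain ⟨C, hC, h⟩ := dlt_bound w hw Finset.univ β hβ.le
  refine Summable.of_nonneg_of_le (fun n => norm_nonneg _) (fun n => ?_)
    ((summable_re hd a.re ha (fun i => (w i).re) hw (d - β.re) (by linarith)).mul_left C)
  have hre : (a + ∑ i, (n i : ℂ) * w i).re = a.re + ∑ i, (n i : ℝ) * (w i).re := by
    simp
  have := h (a + ∑ i, (n i : ℂ) * w i) (by
    rw [hre]
    have : 0 ≤ ∑ i, (n i : ℝ) * (w i).re :=
      Finset.sum_nonneg fun i _ => mul_nonneg (Nat.cast_nonneg _) (hw i).le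
    positivity)
  rw [hre] at this
  simpa [dlt] using this

theorem hasSum_G {d : ℕ} (hd : 1 ≤ d) (a : ℂ) (w : Fin d → ℂ) (ha : 0 < a.re)
    (hw : ∀ i, 0 < (w i).re) (β : ℂ) (hβ : β.re < 0) :
    HasSum (fun n : Fin d → ℕ => ∑ S : Finset (Fin d), (-1 : ℂ) ^ (d - S.card) *
      (a + (∑ i, (n i : ℂ) * w i) + ∑ i ∈ S, w i) ^ β) ((-1 : ℂ) ^ d * a ^ β) := by
  have hsum := (summable_G hd a w ha hw β hβ).of_norm
  have h1 := hsum.hasSum.comp (tendsto_box d)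
  have h2 := tendsto_corner a w ha hw β hβ
  have e := fun M : ℕ => box_sum w (fun x => (a + x) ^ β) M
  simp only [← add_assoc] at e
  have : (-1 : ℂ) ^ d * a ^ β = _ := tendsto_nhds_unique (h2.congr fun M => (e M).symm) h1
  rw [this]
  exact hsum.hasSum

theorem summable_first {d : ℕ} (hd : 1 ≤ d) (a : ℂ) (w : Fin d → ℂ) (ha : 0 < a.re)
    (hw : ∀ i, 0 < (w i).re) (α : ℂ) (hα : (d : ℝ) < α.re) :
    Summable (fun n : Fin d → ℕ => ‖(a + ∑ i, (n i : ℂ) * w i) ^ (-α)‖) := by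
  have hd0 : (0 : ℝ) ≤ d := Nat.cast_nonneg _
  refine Summable.of_nonneg_of_le (fun n => norm_nonneg _) (fun n => ?_)
    ((summable_re hd a.re ha (fun i => (w i).re) hw α.re hα).mul_left
      (Real.exp (Real.pi * |(-α).im|)))
  have hre : (a + ∑ i, (n i : ℂ) * w i).re = a.re + ∑ i, (n i : ℝ) * (w i).re := by
    simp
  have := norm_cpow_le_re (-α) (a + ∑ i, (n i : ℂ) * w i) (by simp; linarith) (by
    rw [hre]
    have : 0 ≤ ∑ i, (n i : ℝ) * (w i).re :=
      Finset.sum_nonneg fun i _ => mul_nonneg (Nat.cast_nonneg _) (hw i).le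
    positivity)
  rwa [hre, neg_re] at this

end BarnesAux

/-- Barnes' series representation for the Barnes zeta function, evaluated in the
region `Re(α) > d` where the defining series converges. -/
theorem barnes_series_representation (d : ℕ) (hd : 1 ≤ d) (a : ℂ) (w : Fin d → ℂ)
    (ha : 0 < a.re) (hw : ∀ i, 0 < (w i).re) (N : ℕ)
    (α : ℂ) (hα : (d : ℝ) < α.re) (hαint : ∀ k : ℕ, 1 ≤ k → α ≠ (k : ℂ))
    (s : ℕ → ℂ) (r : ℝ) (hr : 0 < r)
    (hs : ∀ z : ℂ, 0 < ‖z‖ → ‖z‖ < r →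
      HasSum (fun n : ℕ => s n * z ^ n / (n.factorial : ℂ))
        (z ^ d * ∏ i, (Complex.exp (w i * z) - 1)⁻¹)) :
    Summable (fun n : Fin d → ℕ => ‖(a + ∑ i, (n i : ℂ) * w i) ^ (-α)‖) ∧
    Summable (fun n : Fin d → ℕ =>
      ‖(a + ∑ i, (n i : ℂ) * w i) ^ (-α) -
        ∑ m ∈ Finset.range (N + 1), s m / (m.factorial : ℂ) *
          (Complex.Gamma (1 - α) / Complex.Gamma ((d : ℂ) - α - (m : ℂ) + 1)) *
          ∑ S : Finset (Fin d), (-1 : ℂ) ^ (d - S.card) *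
            (a + (∑ i, (n i : ℂ) * w i) + ∑ i ∈ S, w i) ^ ((d : ℂ) - α - (m : ℂ))‖) ∧
    ∑' n : Fin d → ℕ, (a + ∑ i, (n i : ℂ) * w i) ^ (-α)
      = (∑' n : Fin d → ℕ,
          ((a + ∑ i, (n i : ℂ) * w i) ^ (-α) -
            ∑ m ∈ Finset.range (N + 1), s m / (m.factorial : ℂ) *
              (Complex.Gamma (1 - α) / Complex.Gamma ((d : ℂ) - α - (m : ℂ) + 1)) *
              ∑ S : Finset (Fin d), (-1 : ℂ) ^ (d - S.card) *
                (a + (∑ i, (n i : ℂ) * w i) + ∑ i ∈ S, w i) ^ ((d : ℂ) - α - (m : ℂ))))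
        + (-1 : ℂ) ^ d *
          ∑ m ∈ Finset.range (N + 1), s m / (m.factorial : ℂ) *
            (Complex.Gamma (1 - α) / Complex.Gamma ((d : ℂ) - α - (m : ℂ) + 1)) *
            a ^ ((d : ℂ) - α - (m : ℂ)) := by
  have hA := BarnesAux.summable_first hd a w ha hw α hα
  have hβ : ∀ m : ℕ, ((d : ℂ) - α - (m : ℂ)).re < 0 := by
    intro m
    have : (0 : ℝ) ≤ m := Nat.cast_nonneg _
    simp
    linarith
  have hG : ∀ m ∈ Finset.range (N + 1), HasSum (fun n : Fin d → ℕ => s m / (m.factorial : ℂ) *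
          (Complex.Gamma (1 - α) / Complex.Gamma ((d : ℂ) - α - (m : ℂ) + 1)) *
          ∑ S : Finset (Fin d), (-1 : ℂ) ^ (d - S.card) *
            (a + (∑ i, (n i : ℂ) * w i) + ∑ i ∈ S, w i) ^ ((d : ℂ) - α - (m : ℂ)))
          (s m / (m.factorial : ℂ) *
          (Complex.Gamma (1 - α) / Complex.Gamma ((d : ℂ) - α - (m : ℂ) + 1)) *
          ((-1 : ℂ) ^ d * a ^ ((d : ℂ) - α - (m : ℂ)))) :=
    fun m _ => (BarnesAux.hasSum_G hd a w ha hw _ (hβ m)).mul_left _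
  have hB := hasSum_sum hG
  have hAB := hA.of_norm.hasSum.sub hB
  refine ⟨hA, hAB.summable.norm, ?_⟩
  rw [hAB.tsum_eq, Finset.mul_sum, sub_add, eq_comm, sub_eq_self, ← Finset.sum_sub_distrib]
  refine Finset.sum_eq_zero fun m _ => ?_
  ring
end

section
/- Let d ≥ 1, let a, w_1,…,w_d ∈ ℂ with Re(a) > 0 and Re(w_i) > 0, and let N be a non-negative integer. Let s : ℕ → ℂ and r > 0 satisfy Σ_{n=0}^∞ s_n z^n/n! = z^d ∏_{i=1}^d (e^{w_i z} − 1)^{−1} for all z with 0 < |z| < r. Then for every α ∈ ℂ with Re(α) > d − 1 − N and α not a positive integer, the family n ↦ (a+n·w)^{−α} − Σ_{m=0}^{N} (s_m/m!) · (Γ(1−α)/Γ(d−α−m+1)) · G[(a+n·w+x)^{d−α−m}]_{x=w}, indexed by n ∈ ℕ_0^d, is absolutely summable (all complex powers being principal-branch). -/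
open Complex

lemma bz_gamma (β : ℂ) (j : ℕ) :
    (Gamma (β + 1))⁻¹ * (Ring.choose β j * (j.factorial : ℂ)) = (Gamma (β - j + 1))⁻¹ := by
  have key : ∀ j : ℕ, Ring.choose β j * (j.factorial : ℂ) = (descPochhammer ℤ j).smeval β := by
    intro j
    rw [Ring.descPochhammer_eq_factorial_smul_choose, nsmul_eq_mul, mul_comm]
  rw [key]
  induction j with
  | zero => simp
  | succ j ih =>
    have h1 : (descPochhammer ℤ (j+1)).smeval β = (descPochhammer ℤ j).smeval β * (β - j) := by
      simp [descPochhammer_succ_right, Polynomial.smeval_mul, Polynomial.smeval_natCast]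
    rw [h1, ← mul_assoc, ih]
    have := Complex.one_div_Gamma_eq_self_mul_one_div_Gamma_add_one (β - j)
    push_cast
    rw [show β - (j + 1) + 1 = β - j by ring, this]
    ring

lemma bz_taylor {ι : Type*} {l : Filter ι} (Z : ι → ℂ) (hZ : ∀ n, 0 < (Z n).re)
    (hT : Filter.Tendsto (fun n => ‖Z n‖) l Filter.atTop) (h β : ℂ) (J : ℕ) :
    (fun n => (Z n + h) ^ β - ∑ j ∈ Finset.range J, Ring.choose β j * h ^ j * Z n ^ (β - j))
      =O[l] fun n => ‖Z n‖ ^ (β.re - J) := by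
  have hne : ∀ n, Z n ≠ 0 := fun n hn => by simpa [hn] using hZ n
  have hu : Filter.Tendsto (fun n => h / Z n) l (nhds 0) := by
    rw [tendsto_zero_iff_norm_tendsto_zero]
    simp only [norm_div]
    exact hT.const_div_atTop _
  have h1 := (one_add_cpow_hasFPowerSeriesAt_zero (a := β)).isBigO_sub_partialSum_pow J
  have h2 := h1.comp_tendsto hu
  have h3 : (fun n => Z n ^ β) =O[l] fun n => ‖Z n‖ ^ β.re := by
    refine Asymptotics.IsBigO.of_bound (Real.exp (Real.pi * |β.im|)) (Filter.Eventually.of_forall fun n => ?_)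
    have := Complex.norm_cpow_le (Z n) β
    refine this.trans ?_
    rw [div_eq_mul_inv, ← Real.exp_neg, mul_comm, Real.norm_of_nonneg (by positivity)]
    gcongr
    have := abs_arg_le_pi (Z n)
    calc -(arg (Z n) * β.im) ≤ |arg (Z n) * β.im| := neg_le_abs _
      _ = |arg (Z n)| * |β.im| := abs_mul _ _
      _ ≤ _ := by gcongr
  have h4 := h3.mul h2
  refine (h4.congr' ?_ (Filter.EventuallyEq.refl _ _)).trans ?_
  · have hev : ∀ᶠ n in l, ‖h / Z n‖ < 1 := by
      have h0 := hu.norm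
      rw [norm_zero] at h0
      exact h0.eventually (gt_mem_nhds one_pos)
    filter_upwards [hev] with n hn
    have e1 : (Z n + h) ^ β = Z n ^ β * (1 + h / Z n) ^ β := by
      have hpos : 0 < (1 + h / Z n).re := by
        have := (abs_le.1 ((abs_re_le_norm (h / Z n)))).1
        rw [add_re, one_re]; linarith
      have hne' : 1 + h / Z n ≠ 0 := fun h0 => by simp [h0] at hpos
      have e0 : Z n + h = Z n * (1 + h / Z n) := by
        have := hne n
        field_simp
      rw [e0, cpow_def_of_ne_zero (mul_ne_zero (hne n) hne'), cpow_def_of_ne_zero (hne n),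
        cpow_def_of_ne_zero hne', Complex.log_mul (hne n) hne', add_mul, Complex.exp_add]
      · have a1 := abs_arg_lt_pi_div_two_iff.2 (Or.inl (hZ n))
        have a2 := abs_arg_lt_pi_div_two_iff.2 (Or.inl hpos)
        rw [abs_lt] at a1 a2
        constructor <;> linarith
    rw [e1]
    simp only [Function.comp, zero_add, mul_sub, FormalMultilinearSeries.partialSum,
      binomialSeries_apply, Finset.mul_sum]
    congr 1
    refine Finset.sum_congr rfl fun j _ => ?_
    rw [Complex.cpow_sub _ _ (hne n), cpow_natCast]
    simp [div_pow]
    ring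
  · refine Asymptotics.IsBigO.of_bound (‖h‖ ^ J) (Filter.Eventually.of_forall fun n => ?_)
    have hp : 0 < ‖Z n‖ := norm_pos_iff.2 (hne n)
    simp only [Function.comp, norm_mul, norm_pow, norm_div, norm_norm, Real.norm_of_nonneg (Real.rpow_nonneg (norm_nonneg (Z n)) _)]
    rw [Real.rpow_sub hp, Real.rpow_natCast, div_pow]
    apply le_of_eq
    ring

lemma bz_summable_prod (f : ℕ → ℝ) (hf : Summable f) (h0 : ∀ n, 0 ≤ f n) (d : ℕ) :
    Summable fun n : Fin d → ℕ => ∏ i, f (n i) := by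
  induction d with
  | zero => exact Summable.of_finite
  | succ d ih =>
    have := hf.mul_of_nonneg ih h0 (fun n => Finset.prod_nonneg fun i _ => h0 _)
    rw [← (Fin.consEquiv (fun _ => ℕ)).summable_iff]
    refine this.congr fun x => ?_
    simp [Fin.consEquiv, Fin.prod_univ_succ]

lemma bz_lower (d : ℕ) (a : ℂ) (w : Fin d → ℂ) (ha : 0 < a.re) (hw : ∀ i, 0 < (w i).re) :
    ∃ c > 0, ∀ n : Fin d → ℕ, ∀ i, c * (1 + (n i : ℝ)) ≤ (a + ∑ i, (n i : ℂ) * w i).re := by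
  have : ∃ c > 0, c ≤ a.re ∧ ∀ i, c ≤ (w i).re := by
    have h1 : ∀ᶠ c in nhdsWithin (0:ℝ) (Set.Ioi 0), c ≤ a.re :=
      (eventually_nhdsWithin_of_eventually_nhds (ge_mem_nhds ha))
    have h2 : ∀ᶠ c in nhdsWithin (0:ℝ) (Set.Ioi 0), ∀ i, c ≤ (w i).re :=
      Filter.eventually_all.2 fun i => (eventually_nhdsWithin_of_eventually_nhds (ge_mem_nhds (hw i)))
    obtain ⟨c, hc, h3, h4⟩ := ((eventually_mem_nhdsWithin).and (h1.and h2)).exists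
    exact ⟨c, hc, h3, h4⟩
  obtain ⟨c, hc, h1, h2⟩ := this
  refine ⟨c, hc, fun n i => ?_⟩
  have : (n i : ℝ) * (w i).re ≤ ∑ i, (n i : ℝ) * (w i).re :=
    Finset.single_le_sum (f := fun i => (n i : ℝ) * (w i).re)
      (fun j _ => mul_nonneg (Nat.cast_nonneg _) (hw j).le) (Finset.mem_univ i)
  have h3 : (n i : ℝ) * c ≤ n i * (w i).re := by gcongr; exact h2 i
  simp
  linarith

lemma bz_summable (d : ℕ) (hd : 1 ≤ d) (a : ℂ) (w : Fin d → ℂ) (ha : 0 < a.re)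
    (hw : ∀ i, 0 < (w i).re) (σ : ℝ) (hσ : σ < -d) :
    Summable fun n : Fin d → ℕ => ‖a + ∑ i, (n i : ℂ) * w i‖ ^ σ := by
  obtain ⟨c, hc, hlow⟩ := bz_lower d a w ha hw
  have hd0 : (0:ℝ) < d := by exact_mod_cast hd
  have h1 : Summable fun k : ℕ => (c * (1 + (k : ℝ))) ^ (σ / d) := by
    have : Summable fun k : ℕ => ((k : ℝ)) ^ (σ / d) := by
      rw [Real.summable_nat_rpow, div_lt_iff₀ hd0]; linarith
    have := ((summable_nat_add_iff 1).2 this).mul_left (c ^ (σ / d))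
    refine this.congr fun k => ?_
    rw [Real.mul_rpow hc.le (by positivity)]
    push_cast
    rw [add_comm]
  refine Summable.of_nonneg_of_le (fun n => by positivity) (fun n => ?_)
    (bz_summable_prod _ h1 (fun n => by positivity) d)
  have hb : ∀ i, c * (1 + (n i : ℝ)) ≤ ‖a + ∑ i, (n i : ℂ) * w i‖ := fun i =>
    (hlow n i).trans ((le_abs_self _).trans (abs_re_le_norm _))
  calc ‖a + ∑ i, (n i : ℂ) * w i‖ ^ σ = ∏ i : Fin d, ‖a + ∑ i, (n i : ℂ) * w i‖ ^ (σ / d) := by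
        rw [Finset.prod_const, Finset.card_univ, Fintype.card_fin, ← Real.rpow_natCast,
          ← Real.rpow_mul (norm_nonneg _), div_mul_cancel₀ _ hd0.ne']
    _ ≤ _ := by
        refine Finset.prod_le_prod (fun i _ => by positivity) fun i _ => ?_
        exact Real.rpow_le_rpow_of_nonpos (by positivity) (hb i)
          (div_nonpos_of_nonpos_of_nonneg (by linarith) hd0.le)

lemma bz_tendsto (d : ℕ) (a : ℂ) (w : Fin d → ℂ) (ha : 0 < a.re) (hw : ∀ i, 0 < (w i).re) :
    Filter.Tendsto (fun n : Fin d → ℕ => ‖a + ∑ i, (n i : ℂ) * w i‖) Filter.cofinite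
      Filter.atTop := by
  obtain ⟨c, hc, hlow⟩ := bz_lower d a w ha hw
  rw [Filter.tendsto_atTop]
  intro b
  rw [Filter.eventually_cofinite]
  obtain ⟨K, hK⟩ := exists_nat_gt (b / c)
  refine (Set.finite_Iic (fun _ : Fin d => K)).subset fun n hn => ?_
  simp only [Set.mem_ofPred_eq, not_le] at hn
  intro i
  have h1 := (hlow n i).trans ((le_abs_self _).trans (abs_re_le_norm _))
  have h2 : b < K * c := (div_lt_iff₀ hc).1 hK
  have h3 : (n i : ℝ) < K := by
    have : c * (n i : ℝ) < c * K := by nlinarith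
    exact lt_of_mul_lt_mul_left this hc.le
  exact_mod_cast h3.le

lemma bz_prod {R : Type*} [CommRing R] (d : ℕ) (f : Fin d → R) :
    ∏ i, (f i - 1) = ∑ S : Finset (Fin d), (-1 : R) ^ (d - S.card) * ∏ i ∈ S, f i := by
  simp only [sub_eq_add_neg]
  rw [Fintype.prod_add]
  refine Finset.sum_congr rfl fun S _ => ?_
  rw [Finset.prod_const, Finset.card_compl, Fintype.card_fin, mul_comm]

lemma bz_exp_prod {d : ℕ} (w : Fin d → ℂ) (S : Finset (Fin d)) :
    ∏ i ∈ S, PowerSeries.rescale (w i) (PowerSeries.exp ℂ)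
      = PowerSeries.rescale (∑ i ∈ S, w i) (PowerSeries.exp ℂ) := by
  classical
  induction S using Finset.induction_on with
  | empty => simp
  | insert i S hi ih =>
    rw [Finset.prod_insert hi, Finset.sum_insert hi, ih, PowerSeries.exp_mul_exp_eq_exp_add]

/-- The Taylor coefficients of `∏ (e^{w_i z} - 1)`. -/
noncomputable def bzP (d : ℕ) (w : Fin d → ℂ) (j : ℕ) : ℂ :=
  ∑ S : Finset (Fin d), (-1 : ℂ) ^ (d - S.card) * ((∑ i ∈ S, w i) ^ j / (j.factorial : ℂ))

lemma bzP_eq_zero (d : ℕ) (w : Fin d → ℂ) (j : ℕ) (hj : j < d) : bzP d w j = 0 := by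
  have h1 : PowerSeries.coeff j (∏ i, (PowerSeries.rescale (w i) (PowerSeries.exp ℂ) - 1))
      = bzP d w j := by
    rw [bz_prod, map_sum]
    refine Finset.sum_congr rfl fun S _ => ?_
    rw [bz_exp_prod]
    have : (-1 : PowerSeries ℂ) ^ (d - S.card) = PowerSeries.C ((-1 : ℂ) ^ (d - S.card)) := by simp
    rw [this, PowerSeries.coeff_C_mul, PowerSeries.coeff_rescale, PowerSeries.coeff_exp]
    simp [div_eq_mul_inv]
  rw [← h1]
  have h2 : (PowerSeries.X : PowerSeries ℂ) ^ d ∣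
      ∏ i, (PowerSeries.rescale (w i) (PowerSeries.exp ℂ) - 1) := by
    have : (PowerSeries.X : PowerSeries ℂ) ^ d = ∏ i : Fin d, PowerSeries.X := by simp
    rw [this]
    refine Finset.prod_dvd_prod_of_dvd _ _ fun i _ => ?_
    rw [PowerSeries.X_dvd_iff]
    rw [map_sub, ← PowerSeries.coeff_zero_eq_constantCoeff_apply, PowerSeries.coeff_rescale]
    simp
  exact PowerSeries.X_pow_dvd_iff.1 h2 j hj

lemma bzP_hasSum (d : ℕ) (w : Fin d → ℂ) (z : ℂ) :
    HasSum (fun j => bzP d w j * z ^ j) (∏ i, (Complex.exp (w i * z) - 1)) := by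
  rw [bz_prod]
  simp only [bzP, Finset.sum_mul]
  refine hasSum_sum fun S _ => ?_
  have := (NormedSpace.expSeries_div_hasSum_exp ((∑ i ∈ S, w i) * z)).mul_left
    ((-1 : ℂ) ^ (d - S.card))
  rw [← Complex.exp_eq_exp_ℂ, Finset.sum_mul, Complex.exp_sum, ← Finset.sum_mul] at this
  refine this.congr_fun ?_
  intro j
  rw [mul_pow]; ring

lemma bz_exp_ne (w : ℂ) (hw : 0 < w.re) : ∀ᶠ z in nhdsWithin (0:ℂ) {0}ᶜ, Complex.exp (w * z) - 1 ≠ 0 := by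
  have h : HasDerivAt (fun z => Complex.exp (w * z) - 1) w 0 := by
    have := (((hasDerivAt_id (0:ℂ)).const_mul w).cexp).sub_const 1
    simpa using this
  have := h.eventually_ne (c := 0) (by rintro rfl; simp at hw)
  exact this

lemma bz_cauchy (d : ℕ) (hd : 1 ≤ d) (w : Fin d → ℂ) (hw : ∀ i, 0 < (w i).re)
    (s : ℕ → ℂ) (r : ℝ) (hr : 0 < r)
    (hs : ∀ z : ℂ, 0 < ‖z‖ → ‖z‖ < r →
      HasSum (fun n : ℕ => s n * z ^ n / (n.factorial : ℂ))
        (z ^ d * ∏ i, (Complex.exp (w i * z) - 1)⁻¹)) (p : ℕ) :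
    ∑ k ∈ Finset.range (p + 1), s k / (k.factorial : ℂ) * bzP d w (p - k)
      = if p = d then 1 else 0 := by
  set c : ℕ → ℂ := fun p => ∑ k ∈ Finset.range (p + 1), s k / (k.factorial : ℂ) * bzP d w (p - k)
    with hc
  have hc0 : c 0 = 0 := by simp [hc, bzP_eq_zero d w 0 hd]
  have h1 : ∀ᶠ z in nhdsWithin (0:ℂ) {0}ᶜ, HasSum (fun n => z ^ n * c n) (z ^ d) := by
    have e1 : ∀ᶠ z in nhdsWithin (0:ℂ) {0}ᶜ, ∀ i, Complex.exp (w i * z) - 1 ≠ 0 :=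
      Filter.eventually_all.2 fun i => bz_exp_ne (w i) (hw i)
    have e2 : ∀ᶠ z in nhdsWithin (0:ℂ) {0}ᶜ, z ∈ Metric.ball (0:ℂ) r :=
      eventually_nhdsWithin_of_eventually_nhds (Metric.ball_mem_nhds _ hr)
    filter_upwards [e1, e2, eventually_mem_nhdsWithin] with z hz1 hz2 hz3
    have a1 := hs z (norm_pos_iff.2 hz3) (by simpa using hz2)
    have a2 := bzP_hasSum d w z
    have a3 := hasSum_sum_range_mul_of_summable_norm a1.summable.norm a2.summable.norm
    rw [a1.tsum_eq, a2.tsum_eq, mul_assoc, ← Finset.prod_mul_distrib,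
      Finset.prod_eq_one (fun i _ => inv_mul_cancel₀ (hz1 i)), mul_one] at a3
    refine a3.congr_fun fun n => ?_
    rw [hc, Finset.mul_sum]
    refine Finset.sum_congr rfl fun k hk => ?_
    have : z ^ n = z ^ k * z ^ (n - k) := by
      rw [← pow_add]; congr 1; have := Finset.mem_range.1 hk; omega
    rw [this]; ring
  have h2 : ∀ᶠ z in nhds (0:ℂ), HasSum (fun n => z ^ n * c n) (z ^ d) := by
    rw [eventually_nhdsWithin_iff] at h1
    filter_upwards [h1] with z hz
    by_cases h : z = 0
    · subst h
      rw [zero_pow (by omega)]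
      convert hasSum_zero (α := ℂ) (β := ℕ) using 2 with n
      rcases n with _ | n <;> simp [hc0]
    · exact hz h
  have p1 : HasFPowerSeriesAt (fun z : ℂ => z ^ d) (FormalMultilinearSeries.ofScalars ℂ c) 0 := by
    rw [hasFPowerSeriesAt_iff]
    simpa using h2
  have p2 : HasFPowerSeriesAt (fun z : ℂ => z ^ d)
      (FormalMultilinearSeries.ofScalars ℂ (fun p => if p = d then (1:ℂ) else 0)) 0 := by
    rw [hasFPowerSeriesAt_iff]
    refine Filter.Eventually.of_forall fun z => ?_
    have := hasSum_ite_eq d (z ^ d)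
    rw [zero_add]
    refine this.congr_fun fun n => ?_
    by_cases h : n = d
    · simp [h]
    · simp [h]
  have := congr_arg (FormalMultilinearSeries.coeff · p) (p1.eq_formalMultilinearSeries p2)
  simpa using this

lemma bz_main_part (d : ℕ) (hd : 1 ≤ d) (w : Fin d → ℂ) (hw : ∀ i, 0 < (w i).re) (N : ℕ)
    (s : ℕ → ℂ) (r : ℝ) (hr : 0 < r)
    (hs : ∀ z : ℂ, 0 < ‖z‖ → ‖z‖ < r →
      HasSum (fun n : ℕ => s n * z ^ n / (n.factorial : ℂ))
        (z ^ d * ∏ i, (Complex.exp (w i * z) - 1)⁻¹))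
    (α : ℂ) (hαint : ∀ k : ℕ, 1 ≤ k → α ≠ (k : ℂ)) (z : ℂ) :
    ∑ m ∈ Finset.range (N + 1), s m / (m.factorial : ℂ) *
          (Complex.Gamma (1 - α) / Complex.Gamma ((d : ℂ) - α - (m : ℂ) + 1)) *
          ∑ S : Finset (Fin d), (-1 : ℂ) ^ (d - S.card) *
            ∑ j ∈ Finset.range (d + N + 1 - m), Ring.choose ((d : ℂ) - α - (m : ℂ)) j *
              (∑ i ∈ S, w i) ^ j * z ^ ((d : ℂ) - α - (m : ℂ) - j) = z ^ (-α) := by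
  set φ : ℕ → ℂ := fun p => Complex.Gamma (1 - α) * (Complex.Gamma ((d : ℂ) - α - (p : ℂ) + 1))⁻¹ *
    z ^ ((d : ℂ) - α - (p : ℂ)) with hφ
  have step1 : ∀ m, s m / (m.factorial : ℂ) *
          (Complex.Gamma (1 - α) / Complex.Gamma ((d : ℂ) - α - (m : ℂ) + 1)) *
          ∑ S : Finset (Fin d), (-1 : ℂ) ^ (d - S.card) *
            ∑ j ∈ Finset.range (d + N + 1 - m), Ring.choose ((d : ℂ) - α - (m : ℂ)) j *
              (∑ i ∈ S, w i) ^ j * z ^ ((d : ℂ) - α - (m : ℂ) - j)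
      = ∑ j ∈ Finset.range (d + N + 1 - m), s m / (m.factorial : ℂ) * bzP d w j * φ (m + j) := by
    intro m
    simp only [Finset.mul_sum, bzP, Finset.sum_mul]
    rw [Finset.sum_comm]
    refine Finset.sum_congr rfl fun j _ => Finset.sum_congr rfl fun S _ => ?_
    have hf : (j.factorial : ℂ) ≠ 0 := by exact_mod_cast j.factorial_ne_zero
    have e : (d : ℂ) - α - ((m + j : ℕ) : ℂ) = (d : ℂ) - α - m - j := by push_cast; ring
    simp only [hφ]
    rw [e, ← bz_gamma]
    generalize (Gamma ((d : ℂ) - α - m + 1)) = g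
    field_simp
  rw [Finset.sum_congr rfl fun m _ => step1 m]
  have step2 : ∑ m ∈ Finset.range (N + 1), ∑ j ∈ Finset.range (d + N + 1 - m),
        s m / (m.factorial : ℂ) * bzP d w j * φ (m + j)
      = ∑ m ∈ Finset.range (d + N + 1), ∑ j ∈ Finset.range (d + N + 1 - m),
        s m / (m.factorial : ℂ) * bzP d w j * φ (m + j) := by
    refine Finset.sum_subset (fun x hx => ?_) fun m _ hm => Finset.sum_eq_zero fun j hj => ?_
    · rw [Finset.mem_range] at *; omega
    · rw [Finset.mem_range] at *
      rw [bzP_eq_zero d w j (by omega)]; simp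
  rw [step2, ← Finset.sum_range_diag_flip (d + N + 1)
    (fun m j => s m / (m.factorial : ℂ) * bzP d w j * φ (m + j))]
  have step3 : ∀ p, ∑ k ∈ Finset.range (p + 1),
      s k / (k.factorial : ℂ) * bzP d w (p - k) * φ (k + (p - k)) = if p = d then φ p else 0 := by
    intro p
    have : ∑ k ∈ Finset.range (p + 1),
      s k / (k.factorial : ℂ) * bzP d w (p - k) * φ (k + (p - k)) =
      (∑ k ∈ Finset.range (p + 1), s k / (k.factorial : ℂ) * bzP d w (p - k)) * φ p := by
      rw [Finset.sum_mul]
      refine Finset.sum_congr rfl fun k hk => ?_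
      have := Finset.mem_range.1 hk
      rw [show k + (p - k) = p by omega]
    rw [this, bz_cauchy d hd w hw s r hr hs p]
    split_ifs <;> simp
  rw [Finset.sum_congr rfl fun p _ => step3 p, Finset.sum_ite_eq',
    if_pos (Finset.mem_range.2 (by omega))]
  have hg : Complex.Gamma (1 - α) ≠ 0 := by
    refine Complex.Gamma_ne_zero fun m hm => hαint (m + 1) (by omega) ?_
    push_cast
    linear_combination -hm
  simp only [hφ]
  rw [show (d : ℂ) - α - d = -α by ring, show -α + 1 = 1 - α by ring, mul_inv_cancel₀ hg, one_mul]

/-- Absolute convergence of the series in Barnes' representation for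
`Re(α) > d − 1 − N`. -/
theorem barnes_series_abs_summable (d : ℕ) (hd : 1 ≤ d) (a : ℂ) (w : Fin d → ℂ)
    (ha : 0 < a.re) (hw : ∀ i, 0 < (w i).re) (N : ℕ)
    (s : ℕ → ℂ) (r : ℝ) (hr : 0 < r)
    (hs : ∀ z : ℂ, 0 < ‖z‖ → ‖z‖ < r →
      HasSum (fun n : ℕ => s n * z ^ n / (n.factorial : ℂ))
        (z ^ d * ∏ i, (Complex.exp (w i * z) - 1)⁻¹))
    (α : ℂ) (hα : (d : ℝ) - 1 - N < α.re) (hαint : ∀ k : ℕ, 1 ≤ k → α ≠ (k : ℂ)) :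
    Summable (fun n : Fin d → ℕ =>
      ‖(a + ∑ i, (n i : ℂ) * w i) ^ (-α) -
        ∑ m ∈ Finset.range (N + 1), s m / (m.factorial : ℂ) *
          (Complex.Gamma (1 - α) / Complex.Gamma ((d : ℂ) - α - (m : ℂ) + 1)) *
          ∑ S : Finset (Fin d), (-1 : ℂ) ^ (d - S.card) *
            (a + (∑ i, (n i : ℂ) * w i) + ∑ i ∈ S, w i) ^ ((d : ℂ) - α - (m : ℂ))‖) := by
  have hZ : ∀ n : Fin d → ℕ, 0 < (a + ∑ i, (n i : ℂ) * w i).re := by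
    intro n
    obtain ⟨c, hc, h⟩ := bz_lower d a w ha hw
    exact lt_of_lt_of_le (by positivity) (h n ⟨0, hd⟩)
  refine Summable.norm (summable_of_isBigO (bz_summable d hd a w ha hw (-α.re - N - 1)
    (by linarith)) ?_)
  have key : ∀ m ∈ Finset.range (N + 1), ∀ S : Finset (Fin d),
      (fun n : Fin d → ℕ => (a + (∑ i, (n i : ℂ) * w i) + ∑ i ∈ S, w i) ^ ((d : ℂ) - α - (m : ℂ)) -
        ∑ j ∈ Finset.range (d + N + 1 - m), Ring.choose ((d : ℂ) - α - (m : ℂ)) j *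
              (∑ i ∈ S, w i) ^ j *
                (a + ∑ i, (n i : ℂ) * w i) ^ ((d : ℂ) - α - (m : ℂ) - j))
      =O[Filter.cofinite] fun n => ‖a + ∑ i, (n i : ℂ) * w i‖ ^ (-α.re - N - 1) := by
    intro m hm S
    have := bz_taylor (fun n : Fin d → ℕ => a + ∑ i, (n i : ℂ) * w i) hZ
      (bz_tendsto d a w ha hw) (∑ i ∈ S, w i) ((d : ℂ) - α - (m : ℂ)) (d + N + 1 - m)
    have hm' := Finset.mem_range.1 hm
    have e : ((d : ℂ) - α - (m : ℂ)).re - ((d + N + 1 - m : ℕ) : ℝ) = -α.re - N - 1 := by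
      rw [Nat.cast_sub (by omega)]
      simp
      ring
    rw [e] at this
    exact this
  have tot := Asymptotics.IsBigO.sum (s := Finset.range (N + 1)) fun m hm =>
    (Asymptotics.IsBigO.sum (s := (Finset.univ : Finset (Finset (Fin d)))) fun S _ =>
      (key m hm S).const_mul_left ((-1 : ℂ) ^ (d - S.card))).const_mul_left
        (s m / (m.factorial : ℂ) *
          (Complex.Gamma (1 - α) / Complex.Gamma ((d : ℂ) - α - (m : ℂ) + 1)))
  refine tot.neg_left.congr_left fun n => ?_
  simp only [Finset.sum_apply, mul_sub, Finset.sum_sub_distrib]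
  rw [bz_main_part d hd w hw N s r hr hs α hαint (a + ∑ i, (n i : ℂ) * w i)]
  ring
end

section
/- Let d ≥ 1 and w_1, …, w_d ∈ ℂ with Re(w_i) > 0 for all i, and let α ∈ ℂ with Re(α) > d. Then Γ(α) · Σ_{n∈ℕ_0^d, n≠0} (n·w)^{−α} = ∫_0^∞ t^{α−1} ( ∏_{i=1}^d (1 − e^{−w_i t})^{−1} − 1 ) dt, where the sum converges absolutely (principal-branch complex powers, with t^{α−1} the principal power of the positive real t) and the integrand is Lebesgue integrable on (0,∞). -/
open Complex MeasureTheory Set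

lemma hb_norm_eq (a r : ℂ) {t : ℝ} (ht : 0 < t) :
    ‖(t : ℂ) ^ (a - 1) * Complex.exp (-(r * t))‖ = t ^ (a.re - 1) * Real.exp (-(r.re * t)) := by
  rw [norm_mul, norm_cpow_eq_rpow_re_of_pos ht, Complex.norm_exp]
  simp

lemma hb_real_int {s b : ℝ} (hs : -1 < s) (hb : 0 < b) :
    IntegrableOn (fun t : ℝ => t ^ s * Real.exp (-(b * t))) (Ioi 0) := by
  have := integrableOn_rpow_mul_exp_neg_mul_rpow hs one_pos hb
  simpa using this

lemma hb_meas (a r : ℂ) :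
    Measurable (fun t : ℝ => (t : ℂ) ^ (a - 1) * Complex.exp (-(r * t))) := by
  fun_prop

lemma hb_int {a r : ℂ} (ha : 0 < a.re) (hr : 0 < r.re) :
    IntegrableOn (fun t : ℝ => (t : ℂ) ^ (a - 1) * Complex.exp (-(r * t))) (Ioi 0) := by
  refine Integrable.mono' (hb_real_int (s := a.re - 1) (by linarith) hr)
    (hb_meas a r).aestronglyMeasurable ?_
  filter_upwards [ae_restrict_mem measurableSet_Ioi] with t ht
  exact (hb_norm_eq a r ht).le

lemma hb_diff {a r : ℂ} (ha : 0 < a.re) (hr : 0 < r.re) :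
    DifferentiableAt ℂ
      (fun r : ℂ => ∫ t in Ioi (0 : ℝ), (t : ℂ) ^ (a - 1) * Complex.exp (-(r * t))) r := by
  have hs : {z : ℂ | r.re / 2 < z.re} ∈ nhds r :=
    (isOpen_lt continuous_const Complex.continuous_re).mem_nhds (by simp; linarith)
  refine (hasDerivAt_integral_of_dominated_loc_of_deriv_le
    (F := fun (r : ℂ) (t : ℝ) => (t : ℂ) ^ (a - 1) * Complex.exp (-(r * t)))
    (F' := fun (r : ℂ) (t : ℝ) => (t : ℂ) ^ (a - 1) * (Complex.exp (-(r * t)) * (-t)))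
    (bound := fun t => t ^ a.re * Real.exp (-(r.re / 2 * t))) hs
    (Filter.Eventually.of_forall fun x => (hb_meas a x).aestronglyMeasurable)
    (hb_int ha hr) ?_ ?_ (hb_real_int (by linarith) (by linarith)) ?_).2.differentiableAt
  · apply Measurable.aestronglyMeasurable
    fun_prop
  · filter_upwards [ae_restrict_mem measurableSet_Ioi] with t ht z hz
    rw [← mul_assoc, norm_mul, hb_norm_eq a z ht]
    have ht' : 0 < t := ht
    have h1 : ‖(-(t : ℂ))‖ = t := by simp [abs_of_pos ht']
    have h2 : t ^ a.re = t ^ (a.re - 1) * t := by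
      rw [← Real.rpow_add_one ht'.ne']; simp
    rw [h1, h2, mul_right_comm]
    have hz' : r.re / 2 < z.re := hz
    gcongr
  · refine Filter.Eventually.of_forall fun t z _ => ?_
    have h : HasDerivAt (fun z : ℂ => -(z * t)) (-(t : ℂ)) z := by
      exact (hasDerivAt_mul_const (t : ℂ)).fun_neg
    exact (h.cexp).const_mul _

lemma hb_gamma {a r : ℂ} (ha : 0 < a.re) (hr : 0 < r.re) :
    ∫ t in Ioi (0 : ℝ), (t : ℂ) ^ (a - 1) * Complex.exp (-(r * t)) = Gamma a * r ^ (-a) := by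
  have hopen : IsOpen {z : ℂ | 0 < z.re} := isOpen_lt continuous_const Complex.continuous_re
  have hF : AnalyticOnNhd ℂ
      (fun r : ℂ => ∫ t in Ioi (0 : ℝ), (t : ℂ) ^ (a - 1) * Complex.exp (-(r * t)))
      {z : ℂ | 0 < z.re} :=
    DifferentiableOn.analyticOnNhd (fun z hz => (hb_diff ha hz).differentiableWithinAt) hopen
  have hG : AnalyticOnNhd ℂ (fun r : ℂ => Gamma a * r ^ (-a)) {z : ℂ | 0 < z.re} := by
    refine DifferentiableOn.analyticOnNhd (fun z hz => ?_) hopen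
    refine DifferentiableAt.differentiableWithinAt ?_
    exact (differentiableAt_id.cpow_const (Or.inl hz)).const_mul _
  refine hF.eqOn_of_preconnected_of_frequently_eq hG
    (convex_halfSpace_re_gt 0).isPreconnected (z₀ := 1) (by simp) ?_ hr
  have ht : Filter.Tendsto (fun x : ℝ => (x : ℂ)) (nhdsWithin 1 {1}ᶜ) (nhdsWithin 1 {1}ᶜ) := by
    refine tendsto_nhdsWithin_iff.2 ⟨?_, ?_⟩
    · exact (Complex.continuous_ofReal.tendsto' 1 1 (by simp)).mono_left nhdsWithin_le_nhds
    · filter_upwards [self_mem_nhdsWithin] with x hx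
      simpa using hx
  refine ht.frequently (Filter.Eventually.frequently ?_)
  filter_upwards [nhdsWithin_le_nhds (lt_mem_nhds (zero_lt_one (α := ℝ)))] with x hx
  rw [integral_cpow_mul_exp_neg_mul_Ioi ha hx, mul_comm, one_div, inv_cpow, cpow_neg]
  rw [arg_ofReal_of_nonneg hx.le]
  exact Real.pi_pos.ne

lemma hb_prod {𝕜 : Type*} [NormedField 𝕜] [CompleteSpace 𝕜] (d : ℕ) (f : Fin d → ℕ → 𝕜)
    (s : Fin d → 𝕜) (hf : ∀ i, Summable fun n => ‖f i n‖) (hs : ∀ i, HasSum (f i) (s i)) :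
    (Summable fun n : Fin d → ℕ => ‖∏ i, f i (n i)‖) ∧
      HasSum (fun n : Fin d → ℕ => ∏ i, f i (n i)) (∏ i, s i) := by
  induction d with
  | zero =>
    refine ⟨(hasSum_unique _).summable, ?_⟩
    simp
  | succ d ih =>
    obtain ⟨h1, h2⟩ := ih (fun i => f i.succ) (fun i => s i.succ) (fun i => hf _) (fun i => hs _)
    have h3 := (hf 0).mul_norm h1
    have h4 := summable_mul_of_summable_norm (hf 0) h1
    have h5 := (hs 0).mul h2 h4
    constructor
    · rw [← (Fin.consEquiv (fun _ => ℕ)).summable_iff]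
      refine h3.congr fun x => ?_
      simp [Fin.consEquiv, Fin.prod_univ_succ]
    · rw [← (Fin.consEquiv (fun _ => ℕ)).hasSum_iff, Fin.prod_univ_succ]
      refine h5.congr_fun fun x => ?_
      simp [Fin.consEquiv, Fin.prod_univ_succ]

lemma hb_sum_aux (d : ℕ) (hd : 1 ≤ d) (x : Fin d → ℝ)
    (hx : ∀ i, 0 < x i) (σ : ℝ) (hσ : (d : ℝ) < σ) :
    Summable (fun n : {n : Fin d → ℕ // n ≠ 0} => (∑ i, (n.1 i : ℝ) * x i) ^ (-σ)) := by
  have hd' : (0 : ℝ) < d := by exact_mod_cast hd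
  have hσ0 : 0 < σ := hd'.trans hσ
  haveI : Nonempty (Fin d) := ⟨⟨0, hd⟩⟩
  obtain ⟨j, hj⟩ := Finite.exists_min x
  have h1 : Summable (fun n : ℕ => ((n : ℝ) + 1) ^ (-(σ / d))) := by
    have := (summable_nat_add_iff 1).2
      (Real.summable_nat_rpow.2 (neg_lt_neg ((one_lt_div hd').2 hσ)))
    simpa using this
  have h2 := (hb_prod d (fun _ n => ((n : ℝ) + 1) ^ (-(σ / d))) _ (fun _ => h1.norm)
    (fun _ => h1.hasSum)).2.summable
  have h3 := (h2.mul_left ((x j / 2) ^ (-σ))).subtype {n : Fin d → ℕ | n ≠ 0}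
  refine Summable.of_nonneg_of_le (fun n => ?_) (fun n => ?_) h3
  · exact Real.rpow_nonneg (Finset.sum_nonneg fun i _ => mul_nonneg (by positivity) (hx i).le) _
  · obtain ⟨n, hn⟩ := n
    simp only [Function.comp]
    obtain ⟨k, hk⟩ := Function.ne_iff.1 hn
    have hk1 : (1 : ℝ) ≤ n k := by exact_mod_cast Nat.one_le_iff_ne_zero.2 hk
    set S : ℝ := ∑ i, (n i : ℝ) with hS
    have hle : ∀ i, (n i : ℝ) ≤ S := fun i =>
      Finset.single_le_sum (f := fun i => (n i : ℝ)) (fun i _ => by positivity) (Finset.mem_univ i)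
    have hS1 : 1 ≤ S := hk1.trans (hle k)
    have hlow : x j / 2 * (S + 1) ≤ ∑ i, (n i : ℝ) * x i := by
      have : S * x j ≤ ∑ i, (n i : ℝ) * x i := by
        rw [hS, Finset.sum_mul]
        exact Finset.sum_le_sum fun i _ => mul_le_mul_of_nonneg_left (hj i) (by positivity)
      nlinarith [hx j]
    have hxj := hx j
    calc (∑ i, (n i : ℝ) * x i) ^ (-σ) ≤ (x j / 2 * (S + 1)) ^ (-σ) :=
          Real.rpow_le_rpow_of_nonpos (by positivity) hlow (by linarith)
      _ = (x j / 2) ^ (-σ) * (S + 1) ^ (-σ) := Real.mul_rpow (by positivity) (by positivity)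
      _ = (x j / 2) ^ (-σ) * ∏ i : Fin d, (S + 1) ^ (-(σ / d)) := by
          rw [Finset.prod_const, Finset.card_univ, Fintype.card_fin, ← Real.rpow_mul_natCast
            (by positivity)]
          congr 2
          field_simp
      _ ≤ _ := by
          refine mul_le_mul_of_nonneg_left (Finset.prod_le_prod (fun i _ => by positivity)
            fun i _ => ?_) (by positivity)
          exact Real.rpow_le_rpow_of_nonpos (by positivity) (by linarith [hle i])
            (by have := div_pos hσ0 hd'; linarith)

lemma hb_pos {d : ℕ} {x : Fin d → ℝ} (hx : ∀ i, 0 < x i) {n : Fin d → ℕ} (hn : n ≠ 0) :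
    0 < ∑ i, (n i : ℝ) * x i := by
  obtain ⟨k, hk⟩ := Function.ne_iff.1 hn
  refine Finset.sum_pos' (fun i _ => mul_nonneg (by positivity) (hx i).le) ⟨k, Finset.mem_univ k, ?_⟩
  exact mul_pos (by exact_mod_cast Nat.pos_of_ne_zero hk) (hx k)

lemma hb_geom {d : ℕ} {w : Fin d → ℂ} (hw : ∀ i, 0 < (w i).re) {t : ℝ} (ht : 0 < t) :
    HasSum (fun n : {n : Fin d → ℕ // n ≠ 0} => Complex.exp (-((∑ i, (n.1 i : ℂ) * w i) * t)))
      ((∏ i, (1 - Complex.exp (-(w i) * t))⁻¹) - 1) := by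
  have hz : ∀ i, ‖Complex.exp (-(w i) * t)‖ < 1 := fun i => by
    rw [Complex.norm_exp]
    have := mul_pos (hw i) ht
    simpa using this
  have h := (hb_prod d (fun i n => Complex.exp (-(w i) * t) ^ n) _
    (fun i => by simpa using summable_geometric_of_lt_one (norm_nonneg _) (hz i))
    (fun i => hasSum_geometric_of_norm_lt_one (hz i))).2
  have h2 : (fun n : Fin d → ℕ => ∏ i, Complex.exp (-(w i) * t) ^ n i) =
      fun n => Complex.exp (-((∑ i, (n i : ℂ) * w i) * t)) := by
    funext n
    simp_rw [← Complex.exp_nat_mul]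
    rw [← Complex.exp_sum, Finset.sum_mul, ← Finset.sum_neg_distrib]
    congr 1
    exact Finset.sum_congr rfl fun i _ => by ring
  rw [h2] at h
  have h3 := hasSum_ite_sub_hasSum h (0 : Fin d → ℕ)
  simp only [Pi.zero_apply, Nat.cast_zero, zero_mul, Finset.sum_const_zero, neg_zero,
    Complex.exp_zero] at h3
  refine (hasSum_subtype_iff_indicator (s := {n : Fin d → ℕ | n ≠ 0})
    (f := fun n : Fin d → ℕ => Complex.exp (-((∑ i, (n i : ℂ) * w i) * t)))).2 ?_
  refine h3.congr_fun fun n => ?_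
  by_cases hn : n = 0 <;> simp [hn, Set.indicator]

lemma hb_integrable_tsum {ι : Type*} [Countable ι] {F : ι → ℝ → ℂ} {f : ℝ → ℂ} {μ : Measure ℝ}
    (hF_int : ∀ i, Integrable (F i) μ) (hF_sum : Summable fun i => ∫ a, ‖F i a‖ ∂μ)
    (hfm : AEStronglyMeasurable f μ) (hf : ∀ᵐ a ∂μ, f a = ∑' i, F i a) : Integrable f μ := by
  refine ⟨hfm, ?_⟩
  have h1 : ∫⁻ a, ‖f a‖ₑ ∂μ ≤ ∑' i, ∫⁻ a, ‖F i a‖ₑ ∂μ := by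
    rw [← lintegral_tsum fun i => (hF_int i).1.enorm]
    refine lintegral_mono_ae ?_
    filter_upwards [hf] with a ha
    rw [ha]
    exact enorm_tsum_le_tsum_enorm
  refine lt_of_le_of_lt h1 ?_
  have h2 : ∀ i, ∫⁻ a, ‖F i a‖ₑ ∂μ = ENNReal.ofReal (∫ a, ‖F i a‖ ∂μ) := fun i =>
    (ofReal_integral_norm_eq_lintegral_enorm (hF_int i)).symm
  simp_rw [h2]
  exact hF_sum.tsum_ofReal_lt_top

/-- Line integral representation of the homogeneous Barnes zeta function:
`Γ(α) ζ_Bh(α|w) = ∫_0^∞ t^{α−1} (∏ᵢ (1−e^{−wᵢt})^{-1} − 1) dt` for `Re(α) > d`. -/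
theorem homogeneous_barnes_integral (d : ℕ) (hd : 1 ≤ d) (w : Fin d → ℂ)
    (hw : ∀ i, 0 < (w i).re) (α : ℂ) (hα : (d : ℝ) < α.re) :
    Summable (fun n : {n : Fin d → ℕ // n ≠ 0} => ‖(∑ i, (n.1 i : ℂ) * w i) ^ (-α)‖) ∧
    IntegrableOn (fun t : ℝ =>
      (t : ℂ) ^ (α - 1) * ((∏ i, (1 - Complex.exp (-(w i) * t))⁻¹) - 1)) (Ioi 0) ∧
    Complex.Gamma α * ∑' n : {n : Fin d → ℕ // n ≠ 0}, (∑ i, (n.1 i : ℂ) * w i) ^ (-α)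
      = ∫ t in Ioi (0 : ℝ),
          (t : ℂ) ^ (α - 1) * ((∏ i, (1 - Complex.exp (-(w i) * t))⁻¹) - 1) := by
  have hα0 : 0 < α.re := lt_of_le_of_lt (Nat.cast_nonneg d) hα
  have hre : ∀ n : Fin d → ℕ, (∑ i, (n i : ℂ) * w i).re = ∑ i, (n i : ℝ) * (w i).re := fun n => by
    simp
  have hpos : ∀ n : {n : Fin d → ℕ // n ≠ 0}, 0 < (∑ i, (n.1 i : ℂ) * w i).re := fun n => by
    rw [hre]; exact hb_pos hw n.2
  have hS := hb_sum_aux d hd (fun i => (w i).re) hw α.re hα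
  simp_rw [← hre] at hS
  have hint : ∀ n : {n : Fin d → ℕ // n ≠ 0}, Integrable (fun t : ℝ =>
      (t : ℂ) ^ (α - 1) * Complex.exp (-((∑ i, (n.1 i : ℂ) * w i) * t)))
      (volume.restrict (Ioi 0)) := fun n => hb_int hα0 (hpos n)
  have hsum : Summable fun n : {n : Fin d → ℕ // n ≠ 0} => ∫ t in Ioi (0 : ℝ),
      ‖(t : ℂ) ^ (α - 1) * Complex.exp (-((∑ i, (n.1 i : ℂ) * w i) * t))‖ := by
    refine (hS.mul_left (Real.Gamma α.re)).congr fun n => ?_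
    rw [setIntegral_congr_fun measurableSet_Ioi fun t ht => hb_norm_eq α _ ht,
      Real.integral_rpow_mul_exp_neg_mul_Ioi hα0 (hpos n), mul_comm, one_div,
      Real.inv_rpow (hpos n).le, Real.rpow_neg (hpos n).le]
  have htsum : ∀ t ∈ Ioi (0 : ℝ),
      (t : ℂ) ^ (α - 1) * ((∏ i, (1 - Complex.exp (-(w i) * t))⁻¹) - 1) =
      ∑' n : {n : Fin d → ℕ // n ≠ 0},
        (t : ℂ) ^ (α - 1) * Complex.exp (-((∑ i, (n.1 i : ℂ) * w i) * t)) := fun t ht =>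
    ((hb_geom hw ht).mul_left _).tsum_eq.symm
  refine ⟨?_, ?_, ?_⟩
  · refine Summable.of_nonneg_of_le (fun _ => norm_nonneg _) (fun n => ?_)
      (hS.mul_left (Real.exp (Real.pi * |α.im|)))
    set z := ∑ i, (n.1 i : ℂ) * w i with hz
    have hzp : 0 < z.re := hpos n
    refine (norm_cpow_le _ _).trans ?_
    rw [div_eq_inv_mul, ← Real.exp_neg]
    refine mul_le_mul ?_ ?_ (by positivity) (by positivity)
    · rw [Real.exp_le_exp]
      calc -(arg z * (-α).im) ≤ |arg z * α.im| := by
            simpa using le_abs_self (arg z * α.im)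
        _ = |arg z| * |α.im| := abs_mul _ _
        _ ≤ _ := mul_le_mul_of_nonneg_right (abs_arg_le_pi z) (abs_nonneg _)
    · rw [neg_re]
      exact Real.rpow_le_rpow_of_nonpos hzp (re_le_norm z) (by linarith)
  · refine hb_integrable_tsum hint hsum ?_ ?_
    · apply Measurable.aestronglyMeasurable
      fun_prop
    · filter_upwards [ae_restrict_mem measurableSet_Ioi] with t ht
      exact htsum t ht
  · rw [setIntegral_congr_fun measurableSet_Ioi htsum,
      ← integral_tsum_of_summable_integral_norm hint hsum, ← tsum_mul_left]
    exact tsum_congr fun n => (hb_gamma hα0 (hpos n)).symm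
end

section
/- Let d ≥ 1, let a, w_1,…,w_d ∈ ℂ with Re(a) > 0 and Re(w_i) > 0, let M be a non-negative integer, and let α ∈ ℂ with Re(α) > d. Let b : ℕ → ℂ and r > 0 satisfy Σ_{k=0}^∞ b_k z^k/k! = z^d ∏_{i=1}^d w_i/(e^{w_i z} − 1) for all z with 0 < |z| < r. Then Σ_{n∈ℕ_0^d} (a+n·w)^{−α} = (Γ(α) ∏_{i=1}^d w_i)^{−1} Σ_{k=0}^{M} (−1)^k b_k Γ(α−d+k) / (k! · a^{α−d+k}) + Γ(α)^{−1} ∫_0^∞ e^{−at} ( t^{α−1} ∏_{i=1}^d (1−e^{−w_i t})^{−1} − (t^{α−d−1}/∏_{i=1}^d w_i) Σ_{k=0}^{M} (−1)^k b_k t^k/k! ) dt, where the series over n converges absolutely and the integrand is Lebesgue integrable on (0,∞) (principal-branch complex powers). -/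
open Complex MeasureTheory Set

lemma aux_integrable {X ι : Type*} [MeasurableSpace X] {μ : Measure X} [Countable ι]
    {F : ι → X → ℂ} {f : X → ℂ} (hF : ∀ i, Integrable (F i) μ)
    (hs : Summable fun i => ∫ x, ‖F i x‖ ∂μ) (hf : AEStronglyMeasurable f μ)
    (h : ∀ᵐ x ∂μ, HasSum (fun i => F i x) (f x)) : Integrable f μ := by
  refine ⟨hf, ?_⟩
  have h1 : ∫⁻ x, ‖f x‖ₑ ∂μ ≤ ∫⁻ x, ∑' i, ‖F i x‖ₑ ∂μ := by
    apply lintegral_mono_ae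
    filter_upwards [h] with x hx
    rw [← hx.tsum_eq]
    exact enorm_tsum_le_tsum_enorm
  refine lt_of_le_of_lt h1 ?_
  rw [lintegral_tsum (fun i => (hF i).1.enorm)]
  have : ∀ i, ∫⁻ x, ‖F i x‖ₑ ∂μ = ENNReal.ofReal (∫ x, ‖F i x‖ ∂μ) := fun i =>
    (ofReal_integral_norm_eq_lintegral_enorm (hF i)).symm
  simp_rw [this]
  rw [← ENNReal.ofReal_tsum_of_nonneg (fun i => integral_nonneg fun x => norm_nonneg _) hs]
  exact ENNReal.ofReal_lt_top

lemma aux_prod {R : Type*} [NormedField R] [CompleteSpace R] (d : ℕ) (f : Fin d → ℕ → R)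
    (hf : ∀ i, Summable fun n => ‖f i n‖) :
    (Summable fun n : Fin d → ℕ => ‖∏ i, f i (n i)‖) ∧
      HasSum (fun n : Fin d → ℕ => ∏ i, f i (n i)) (∏ i, ∑' n, f i n) := by
  induction d with
  | zero =>
    constructor
    · exact (hasSum_fintype _).summable
    · simp
  | succ d ih =>
    obtain ⟨h1, h2⟩ := ih (fun i => f i.succ) (fun i => hf i.succ)
    have h3 := (hf 0).mul_norm h1
    have hp : ∀ p : ℕ × (Fin d → ℕ), ∏ i, f i (Fin.consEquiv (fun _ : Fin (d+1) => ℕ) p i)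
        = f 0 p.1 * ∏ i, f i.succ (p.2 i) := by
      intro p
      rw [Fin.prod_univ_succ]; simp [Fin.consEquiv]
    constructor
    · rw [← (Fin.consEquiv (fun _ : Fin (d+1) => ℕ)).summable_iff]
      refine h3.congr fun p => ?_
      simp only [Function.comp_apply]; rw [hp]
    · have h4 : Summable fun p : ℕ × (Fin d → ℕ) => f 0 p.1 * ∏ i, f i.succ (p.2 i) := h3.of_norm
      have h5 : HasSum (fun p : ℕ × (Fin d → ℕ) => f 0 p.1 * ∏ i, f i.succ (p.2 i))
          ((∑' n, f 0 n) * ∏ i : Fin d, ∑' n, f i.succ n) := by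
        rw [← h2.tsum_eq, tsum_mul_tsum_of_summable_norm (hf 0) h1]
        exact h4.hasSum
      rw [Fin.prod_univ_succ]
      refine (Fin.consEquiv (fun _ : Fin (d+1) => ℕ)).hasSum_iff.1 ?_
      have h6 : (fun n : Fin (d+1) → ℕ => ∏ i, f i (n i)) ∘ (Fin.consEquiv (fun _ : Fin (d+1) => ℕ))
          = (fun p : ℕ × (Fin d → ℕ) => f 0 p.1 * ∏ i, f i.succ (p.2 i)) := funext hp
      rw [h6]
      exact h5

lemma aux_int_real {s c : ℝ} (hs : 0 < s) (hc : 0 < c) :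
    IntegrableOn (fun t : ℝ => t ^ (s - 1) * Real.exp (-(c * t))) (Ioi 0) := by
  have := integrableOn_rpow_mul_exp_neg_mul_rpow (p := 1) (s := s - 1) (b := c) (by linarith)
    one_pos hc
  simpa using this

lemma aux_norm {s z : ℂ} {t : ℝ} (ht : 0 < t) :
    ‖(t : ℂ) ^ (s - 1) * Complex.exp (-(z * t))‖ = t ^ (s.re - 1) * Real.exp (-(z.re * t)) := by
  rw [norm_mul, Complex.norm_cpow_eq_rpow_re_of_pos ht, Complex.norm_exp]
  simp

lemma aux_cont (s z : ℂ) : ContinuousOn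
    (fun t : ℝ => (t : ℂ) ^ (s - 1) * Complex.exp (-(z * t))) (Ioi 0) := by
  refine ContinuousOn.mul ?_ (by fun_prop)
  intro t ht
  exact (Complex.continuousAt_ofReal_cpow_const t (s-1) (Or.inr (ne_of_gt ht))).continuousWithinAt

lemma aux_int {s z : ℂ} (hs : 0 < s.re) (hz : 0 < z.re) :
    IntegrableOn (fun t : ℝ => (t : ℂ) ^ (s - 1) * Complex.exp (-(z * t))) (Ioi 0) := by
  refine Integrable.mono' (aux_int_real hs hz)
    ((aux_cont s z).aestronglyMeasurable measurableSet_Ioi) ?_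
  filter_upwards [ae_restrict_mem measurableSet_Ioi] with t ht
  exact (aux_norm ht).le

lemma aux_gamma {s z : ℂ} (hs : 0 < s.re) (hz : 0 < z.re) :
    ∫ t in Ioi (0:ℝ), (t : ℂ) ^ (s - 1) * Complex.exp (-(z * t)) = z ^ (-s) * Gamma s := by
  have hopen : IsOpen {z : ℂ | 0 < z.re} := isOpen_lt continuous_const Complex.continuous_re
  have hF : AnalyticOnNhd ℂ (fun z : ℂ =>
      ∫ t in Ioi (0:ℝ), (t : ℂ) ^ (s - 1) * Complex.exp (-(z * t))) {z : ℂ | 0 < z.re} := by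
    apply DifferentiableOn.analyticOnNhd _ hopen
    intro x hx
    have hx : 0 < x.re := hx
    have hx2 : 0 < x.re / 2 := by linarith
    refine ((hasDerivAt_integral_of_dominated_loc_of_deriv_le
      (F' := fun z t => (t : ℂ) ^ (s - 1) * (Complex.exp (-(z * t)) * (-t)))
      (s := {z : ℂ | x.re / 2 < z.re})
      (bound := fun t => t ^ (s.re + 1 - 1) * Real.exp (-(x.re / 2 * t)))
      ?_ ?_ ?_ ?_ ?_ ?_ ?_).2).differentiableAt.differentiableWithinAt
    · exact (isOpen_lt continuous_const Complex.continuous_re).mem_nhds (by simp; linarith)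
    · exact Filter.Eventually.of_forall fun z =>
        (aux_cont s z).aestronglyMeasurable measurableSet_Ioi
    · exact aux_int hs hx
    · have := ((aux_cont s x).mul (g := fun t : ℝ => -(t:ℂ)) (by fun_prop)).aestronglyMeasurable
        (μ := volume) measurableSet_Ioi
      refine this.congr (Filter.Eventually.of_forall fun t => ?_)
      simp only [Pi.mul_apply]; ring
    · filter_upwards [ae_restrict_mem measurableSet_Ioi] with t ht z hz
      have ht : 0 < t := ht
      have hz : x.re / 2 < z.re := hz
      rw [← mul_assoc, norm_mul, aux_norm ht, norm_neg, Complex.norm_real, Real.norm_of_nonneg ht.le]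
      have : t ^ (s.re + 1 - 1) = t ^ (s.re - 1) * t := by
        rw [← Real.rpow_add_one ht.ne']; congr 1; ring
      rw [this, mul_assoc, mul_assoc, mul_comm t]
      gcongr
    · exact aux_int_real (by linarith) hx2
    · refine Filter.Eventually.of_forall fun t z _ => ?_
      have h1 : HasDerivAt (fun z : ℂ => -(z * t)) (-t : ℂ) z := by
        simpa using! ((hasDerivAt_id z).mul_const (t:ℂ)).neg
      exact h1.cexp.const_mul _
  have hG : AnalyticOnNhd ℂ (fun z : ℂ => z ^ (-s) * Gamma s) {z : ℂ | 0 < z.re} := by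
    apply DifferentiableOn.analyticOnNhd _ hopen
    intro x hx
    have : DifferentiableAt ℂ (fun z : ℂ => z ^ (-s)) x :=
      differentiableAt_id.cpow (differentiableAt_const _) (Or.inl hx)
    exact (this.mul_const _).differentiableWithinAt
  refine hF.eqOn_of_preconnected_of_frequently_eq hG (z₀ := 1)
    (convex_halfSpace_re_gt 0).isPreconnected (by simp) ?_ hz
  have hreal : ∀ r : ℝ, 0 < r → ∫ t in Ioi (0:ℝ), (t : ℂ) ^ (s - 1) * Complex.exp (-((r:ℂ) * t))
      = (r:ℂ) ^ (-s) * Gamma s := by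
    intro r hr
    rw [integral_cpow_mul_exp_neg_mul_Ioi hs hr, cpow_neg, one_div, inv_cpow]
    rw [Complex.arg_ofReal_of_nonneg hr.le]; exact Real.pi_pos.ne
  have ht : Filter.Tendsto (fun n : ℕ => ((1 + 1 / ((n:ℝ) + 1) : ℝ) : ℂ)) Filter.atTop
      (nhdsWithin 1 {1}ᶜ) := by
    apply tendsto_nhdsWithin_of_tendsto_nhds_of_eventually_within
    · have := (tendsto_one_div_add_atTop_nhds_zero_nat (𝕜 := ℝ)).const_add 1
      have := (Complex.continuous_ofReal.tendsto _).comp this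
      rw [add_zero, Complex.ofReal_one] at this
      exact this
    · refine Filter.Eventually.of_forall fun n => ?_
      have : (0:ℝ) < 1 / ((n:ℝ) + 1) := by positivity
      simp only [mem_compl_iff, mem_singleton_iff, Complex.ofReal_eq_one]
      linarith
  refine ht.frequently (Filter.Eventually.of_forall fun n => ?_).frequently
  exact hreal _ (by positivity)

lemma aux_summable (d : ℕ) (hd : 1 ≤ d) (a : ℝ) (w : Fin d → ℝ) (ha : 0 < a) (hw : ∀ i, 0 < w i)
    (s : ℝ) (hs : (d:ℝ) < s) :
    Summable fun n : Fin d → ℕ => (a + ∑ i, (n i : ℝ) * w i) ^ (-s) := by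
  have hd0 : (0:ℝ) < d := by exact_mod_cast hd
  have hs0 : 0 < s := hd0.trans hs
  obtain ⟨c, hc, hca, hcw⟩ : ∃ c : ℝ, 0 < c ∧ c ≤ a ∧ ∀ i, c ≤ w i := by
    have : Nonempty (Fin d) := ⟨⟨0, hd⟩⟩
    obtain ⟨j, hj⟩ := Finite.exists_min w
    exact ⟨min a (w j), lt_min ha (hw j), min_le_left _ _, fun i => (min_le_right _ _).trans (hj i)⟩
  have hp : Summable fun n : ℕ => ‖((1:ℝ) + n) ^ (-(s / d))‖ := by
    have h1 : 1 < s / d := by rwa [one_lt_div hd0]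
    have := (summable_nat_add_iff 1).2 (Real.summable_nat_rpow.2 (neg_lt_neg h1))
    refine this.congr fun n => ?_
    rw [Real.norm_of_nonneg (by positivity)]
    push_cast; rw [add_comm]
  have hS := (aux_prod d (fun _ n => ((1:ℝ) + n) ^ (-(s / d))) (fun _ => hp)).2.summable
  refine Summable.of_nonneg_of_le (fun n => ?_) (fun n => ?_) (hS.mul_left (c ^ (-s)))
  · have : 0 ≤ ∑ i, (n i : ℝ) * w i := Finset.sum_nonneg fun i _ => by have := hw i; positivity
    positivity
  · have hsum : (0:ℝ) ≤ ∑ i, (n i : ℝ) := by positivity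
    have h1 : c * (1 + ∑ i, (n i : ℝ)) ≤ a + ∑ i, (n i : ℝ) * w i := by
      rw [mul_add, mul_one, Finset.mul_sum]
      refine add_le_add hca (Finset.sum_le_sum fun i _ => ?_)
      rw [mul_comm]
      exact mul_le_mul_of_nonneg_left (hcw i) (by positivity)
    calc _ ≤ (c * (1 + ∑ i, (n i : ℝ))) ^ (-s) :=
          Real.rpow_le_rpow_of_nonpos (by positivity) h1 (by linarith)
      _ = c ^ (-s) * (1 + ∑ i, (n i : ℝ)) ^ (-s) := Real.mul_rpow hc.le (by positivity)
      _ = c ^ (-s) * ∏ _i : Fin d, (1 + ∑ i, (n i : ℝ)) ^ (-(s / d)) := by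
          rw [Finset.prod_const, Finset.card_univ, Fintype.card_fin, ← Real.rpow_natCast,
            ← Real.rpow_mul (by positivity)]
          congr 2; field_simp
      _ ≤ _ := by
          refine mul_le_mul_of_nonneg_left ?_ (by positivity)
          refine Finset.prod_le_prod (fun i _ => by positivity) fun i _ => ?_
          have h0 : 0 < s / d := by positivity
          refine Real.rpow_le_rpow_of_nonpos (by positivity) ?_ (by linarith)
          have := Finset.single_le_sum (f := fun i => (n i : ℝ)) (fun i _ => by positivity)
                (Finset.mem_univ i)
          simpa using this

lemma aux_geom {w : ℂ} (hw : 0 < w.re) {t : ℝ} (ht : 0 < t) :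
    ‖Complex.exp (-w * t)‖ < 1 := by
  rw [Complex.norm_exp, Real.exp_lt_one_iff]
  simp only [neg_mul, neg_re, mul_re, ofReal_re, ofReal_im, mul_zero, sub_zero]
  have := mul_pos hw ht
  linarith

lemma aux_main (d : ℕ) (hd : 1 ≤ d) (a : ℂ) (w : Fin d → ℂ)
    (ha : 0 < a.re) (hw : ∀ i, 0 < (w i).re) (α : ℂ) (hα : (d : ℝ) < α.re) :
    Summable (fun n : Fin d → ℕ => ‖(a + ∑ i, (n i : ℂ) * w i) ^ (-α)‖) ∧
    IntegrableOn (fun t : ℝ => Complex.exp (-a * t) *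
        ((t : ℂ) ^ (α - 1) * ∏ i, (1 - Complex.exp (-(w i) * t))⁻¹)) (Ioi 0) ∧
    ∫ t in Ioi (0:ℝ), Complex.exp (-a * t) *
        ((t : ℂ) ^ (α - 1) * ∏ i, (1 - Complex.exp (-(w i) * t))⁻¹)
      = (∑' n : Fin d → ℕ, (a + ∑ i, (n i : ℂ) * w i) ^ (-α)) * Gamma α := by
  have hα0 : 0 < α.re := lt_of_le_of_lt (by positivity) hα
  set z : (Fin d → ℕ) → ℂ := fun n => a + ∑ i, (n i : ℂ) * w i with hz
  have hzre' : ∀ n, (z n).re = a.re + ∑ i, (n i : ℝ) * (w i).re := by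
    intro n; simp [hz]
  have hzre : ∀ n, 0 < (z n).re := by
    intro n
    rw [hzre']
    have : 0 ≤ ∑ i, (n i : ℝ) * (w i).re :=
      Finset.sum_nonneg fun i _ => by have := hw i; positivity
    positivity
  have hI : ∀ n, IntegrableOn (fun t : ℝ => (t : ℂ) ^ (α - 1) * Complex.exp (-(z n * t))) (Ioi 0) :=
    fun n => aux_int hα0 (hzre n)
  have hN : Summable fun n =>
      ∫ t in Ioi (0:ℝ), ‖(t : ℂ) ^ (α - 1) * Complex.exp (-(z n * t))‖ := by
    have := (aux_summable d hd a.re (fun i => (w i).re) ha hw α.re hα).mul_right (Real.Gamma α.re)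
    refine this.congr fun n => ?_
    rw [setIntegral_congr_fun measurableSet_Ioi (fun t ht => aux_norm ht),
      Real.integral_rpow_mul_exp_neg_mul_Ioi hα0 (hzre n), ← hzre', Real.rpow_neg (hzre n).le,
      one_div, Real.inv_rpow (hzre n).le]
  have hpt : ∀ t ∈ Ioi (0:ℝ), HasSum (fun n => (t : ℂ) ^ (α - 1) * Complex.exp (-(z n * t)))
      (Complex.exp (-a * t) * ((t : ℂ) ^ (α - 1) * ∏ i, (1 - Complex.exp (-(w i) * t))⁻¹)) := by
    intro t ht
    have h1 := (aux_prod d (fun i n => (Complex.exp (-(w i) * t)) ^ n) (fun i => by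
      simpa [norm_pow] using summable_geometric_of_lt_one (norm_nonneg _) (aux_geom (hw i) ht))).2
    simp_rw [fun i => tsum_geometric_of_norm_lt_one (aux_geom (hw i) ht)] at h1
    have h2 := h1.mul_left (Complex.exp (-a * t) * (t : ℂ) ^ (α - 1))
    rw [mul_assoc] at h2
    have h3 : ∀ n : Fin d → ℕ, (t : ℂ) ^ (α - 1) * Complex.exp (-(z n * t)) =
        Complex.exp (-a * t) * (t : ℂ) ^ (α - 1) * ∏ i, (Complex.exp (-(w i) * t)) ^ (n i) := by
      intro n
      simp_rw [← Complex.exp_nat_mul]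
      rw [← Complex.exp_sum]
      have : -(z n * t) = -a * t + ∑ i, (n i : ℂ) * (-(w i) * t) := by
        simp only [hz, add_mul, Finset.sum_mul, neg_add, ← Finset.sum_neg_distrib]
        congr 1
        · ring
        · exact Finset.sum_congr rfl fun i _ => by ring
      rw [this, Complex.exp_add]
      ring
    simp_rw [h3]
    exact h2
  have hcont : AEStronglyMeasurable (fun t : ℝ => Complex.exp (-a * t) *
        ((t : ℂ) ^ (α - 1) * ∏ i, (1 - Complex.exp (-(w i) * t))⁻¹)) (volume.restrict (Ioi 0)) := by
    refine ContinuousOn.aestronglyMeasurable ?_ measurableSet_Ioi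
    refine ContinuousOn.mul (by fun_prop) (ContinuousOn.mul ?_ ?_)
    · intro t ht
      exact (Complex.continuousAt_ofReal_cpow_const t _ (Or.inr (ne_of_gt ht))).continuousWithinAt
    · refine continuousOn_finsetProd _ fun i _ => ContinuousOn.inv₀ (by fun_prop) ?_
      intro t ht h0
      have := aux_geom (hw i) ht
      rw [← sub_eq_zero.1 h0] at this
      simp at this
  have hae : ∀ᵐ t : ℝ ∂(volume.restrict (Ioi (0:ℝ))),
      HasSum (fun n => (t : ℂ) ^ (α - 1) * Complex.exp (-(z n * t)))
      (Complex.exp (-a * t) * ((t : ℂ) ^ (α - 1) * ∏ i, (1 - Complex.exp (-(w i) * t))⁻¹)) := by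
    filter_upwards [ae_restrict_mem measurableSet_Ioi] with t ht using hpt t ht
  have hsum := hasSum_integral_of_summable_integral_norm (μ := volume.restrict (Ioi (0:ℝ))) hI hN
  have hg : (fun n => ∫ t in Ioi (0:ℝ), (t : ℂ) ^ (α - 1) * Complex.exp (-(z n * t)))
      = fun n => z n ^ (-α) * Gamma α := funext fun n => aux_gamma hα0 (hzre n)
  rw [hg] at hsum
  have hG : Gamma α ≠ 0 := Gamma_ne_zero_of_re_pos hα0
  have hsum' : Summable fun n => z n ^ (-α) := (summable_mul_right_iff hG).1 hsum.summable
  refine ⟨hsum'.norm, aux_integrable hI hN hcont hae, ?_⟩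
  rw [← tsum_mul_right, hsum.tsum_eq]
  refine integral_congr_ae ?_
  filter_upwards [hae] with t ht using ht.tsum_eq.symm

theorem barnes_ruijsenaars_representation (d : ℕ) (hd : 1 ≤ d) (a : ℂ) (w : Fin d → ℂ)
    (ha : 0 < a.re) (hw : ∀ i, 0 < (w i).re) (M : ℕ)
    (α : ℂ) (hα : (d : ℝ) < α.re)
    (b : ℕ → ℂ) (r : ℝ) (hr : 0 < r)
    (hb : ∀ z : ℂ, 0 < ‖z‖ → ‖z‖ < r →
      HasSum (fun k : ℕ => b k * z ^ k / (k.factorial : ℂ))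
        (z ^ d * ∏ i, w i / (Complex.exp (w i * z) - 1))) :
    Summable (fun n : Fin d → ℕ => ‖(a + ∑ i, (n i : ℂ) * w i) ^ (-α)‖) ∧
    IntegrableOn (fun t : ℝ =>
      Complex.exp (-a * t) *
        ((t : ℂ) ^ (α - 1) * ∏ i, (1 - Complex.exp (-(w i) * t))⁻¹ -
          (t : ℂ) ^ (α - d - 1) / (∏ i, w i) *
            ∑ k ∈ Finset.range (M + 1), (-1 : ℂ) ^ k * b k * (t : ℂ) ^ k / (k.factorial : ℂ)))
      (Ioi 0) ∧
    ∑' n : Fin d → ℕ, (a + ∑ i, (n i : ℂ) * w i) ^ (-α)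
      = (Complex.Gamma α * ∏ i, w i)⁻¹ *
          ∑ k ∈ Finset.range (M + 1),
            (-1 : ℂ) ^ k * b k * Complex.Gamma (α - d + k) /
              ((k.factorial : ℂ) * a ^ (α - d + k))
        + (Complex.Gamma α)⁻¹ *
            ∫ t in Ioi (0 : ℝ),
              Complex.exp (-a * t) *
                ((t : ℂ) ^ (α - 1) * ∏ i, (1 - Complex.exp (-(w i) * t))⁻¹ -
                  (t : ℂ) ^ (α - d - 1) / (∏ i, w i) *
                    ∑ k ∈ Finset.range (M + 1),
                      (-1 : ℂ) ^ k * b k * (t : ℂ) ^ k / (k.factorial : ℂ)) := by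
  obtain ⟨h1, h2, h3⟩ := aux_main d hd a w ha hw α hα
  have hG : Gamma α ≠ 0 := Gamma_ne_zero_of_re_pos (lt_of_le_of_lt (by positivity) hα)
  have hk : ∀ k : ℕ, 0 < (α - d + k).re := by
    intro k
    have : (0:ℝ) ≤ k := by positivity
    simp only [add_re, sub_re, natCast_re]; linarith
  set P := ∏ i, w i with hP
  -- the subtracted part, as a finite combination of Gamma integrals
  have hterm : ∀ k ∈ Finset.range (M+1), Integrable (fun t : ℝ =>
      ((-1 : ℂ) ^ k * b k / (k.factorial : ℂ) * P⁻¹) *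
       ((t : ℂ) ^ (α - d + k - 1) * Complex.exp (-(a * t)))) (volume.restrict (Ioi 0)) :=
    fun k _ => (aux_int (hk k) ha).const_mul _
  have hsumI := integrable_finsetSum _ hterm
  have hEq : ∀ t ∈ Ioi (0:ℝ), Complex.exp (-a * t) *
        ((t : ℂ) ^ (α - 1) * ∏ i, (1 - Complex.exp (-(w i) * t))⁻¹ -
          (t : ℂ) ^ (α - d - 1) / P *
            ∑ k ∈ Finset.range (M + 1), (-1 : ℂ) ^ k * b k * (t : ℂ) ^ k / (k.factorial : ℂ))
      = Complex.exp (-a * t) * ((t : ℂ) ^ (α - 1) * ∏ i, (1 - Complex.exp (-(w i) * t))⁻¹) -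
        ∑ k ∈ Finset.range (M + 1), ((-1 : ℂ) ^ k * b k / (k.factorial : ℂ) * P⁻¹) *
       ((t : ℂ) ^ (α - d + k - 1) * Complex.exp (-(a * t))) := by
    intro t ht
    have ht0 : (t:ℂ) ≠ 0 := by exact_mod_cast (ne_of_gt ht)
    rw [mul_sub, Finset.mul_sum, Finset.mul_sum]
    congr 1
    refine Finset.sum_congr rfl fun k _ => ?_
    have : (t:ℂ) ^ (α - d + k - 1) = (t:ℂ) ^ (α - d - 1) * (t:ℂ) ^ k := by
      rw [← cpow_natCast, ← cpow_add _ _ ht0]; congr 1; ring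
    rw [this, neg_mul]
    ring
  refine ⟨h1, ?_, ?_⟩
  · exact (integrableOn_congr_fun hEq measurableSet_Ioi).2 (h2.sub hsumI)
  · rw [setIntegral_congr_fun measurableSet_Ioi hEq, integral_sub h2 hsumI, h3,
      integral_finsetSum _ hterm]
    simp_rw [integral_const_mul, fun k => aux_gamma (hk k) ha]
    rw [mul_sub, mul_comm _ (Gamma α), inv_mul_cancel_left₀ hG, Finset.mul_sum, Finset.mul_sum,
      ← sub_eq_iff_eq_add', sub_right_inj]
    refine Finset.sum_congr rfl fun k _ => ?_
    rw [cpow_neg, mul_inv, div_eq_mul_inv, div_eq_mul_inv, mul_inv]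
    ring
end
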